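/- For n ≥ 1 let t_k := trace(A_k), regarded as a real number, and λ_k := (t_k + √(t_k² − 4))/2 for 1 ≤ k ≤ n. Then (n²/2)·log(3/2) ≤ Σ_{k=1}^{n} 2·log(λ_k) ≤ 2n²·log(4). Consequently the total length ℓ(Γ_n) = Σ_{k=1}^{n} 2·log(λ_k) of the first n modular geodesics γ_1, …, γ_n is coarsely equivalent to n². -/

import Mathlib

/-- The matrix `L` in `SL(2, ℤ)`. -/
def L : Matrix.SpecialLinearGroup (Fin 2) ℤ :=
  ⟨!![1, 1; 0, 1], by norm_num [Matrix.det_fin_two_of]⟩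

/-- The matrix `R` in `SL(2, ℤ)`. -/
def R : Matrix.SpecialLinearGroup (Fin 2) ℤ :=
  ⟨!![1, 0; 1, 1], by norm_num [Matrix.det_fin_two_of]⟩

/-- For `n ≥ 1`, the matrix `A_n = L·R·(R·L)^{n-1}` of the modular geodesic
`γ_n` with cutting sequence `LR(RL)^{n-1}`. -/
def A (n : ℕ) : Matrix.SpecialLinearGroup (Fin 2) ℤ :=
  L * R * (R * L) ^ (n - 1)

/-- The trace `t_k` of `A_k`, regarded as a real number. -/
noncomputable def t (k : ℕ) : ℝ :=
  (Matrix.trace ((A k : Matrix.SpecialLinearGroup (Fin 2) ℤ) :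
    Matrix (Fin 2) (Fin 2) ℤ) : ℤ)

/-- The eigenvalue `λ_k = (t_k + √(t_k² - 4))/2` of `A_k` of absolute value
greater than `1`. -/
noncomputable def lam (k : ℕ) : ℝ :=
  (t k + Real.sqrt (t k ^ 2 - 4)) / 2

/-- Nonnegativity of the entries of `(RL)^m` together with bounds on the trace of `A_{m+1}`. -/
lemma entries_aux (m : ℕ) : ∃ a b c d : ℤ,
    (((R * L) ^ m : Matrix.SpecialLinearGroup (Fin 2) ℤ) : Matrix (Fin 2) (Fin 2) ℤ)
      = !![a, b; c, d] ∧ 0 ≤ a ∧ 0 ≤ b ∧ 0 ≤ c ∧ 0 ≤ d ∧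
    2 * (3 / 2 : ℝ) ^ (m + 1) ≤ 2 * a + b + c + d ∧
    (2 * a + b + c + d : ℝ) ≤ 4 ^ (m + 1) := by
  induction m with
  | zero =>
    refine ⟨1, 0, 0, 1, ?_, by norm_num, by norm_num, by norm_num, by norm_num,
      by norm_num, by norm_num⟩
    simp [Matrix.one_fin_two]
  | succ m ih =>
    obtain ⟨a, b, c, d, h, ha, hb, hc, hd, h1, h2⟩ := ih
    refine ⟨a + b, a + 2 * b, c + d, c + 2 * d, ?_, by omega, by omega, by omega, by omega,
      ?_, ?_⟩
    · rw [pow_succ, Matrix.SpecialLinearGroup.coe_mul, h, Matrix.SpecialLinearGroup.coe_mul]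
      simp [R, L, Matrix.mul_fin_two]
      ring_nf
      simp
    all_goals
      have ha' : (0 : ℝ) ≤ a := by exact_mod_cast ha
      have hb' : (0 : ℝ) ≤ b := by exact_mod_cast hb
      have hc' : (0 : ℝ) ≤ c := by exact_mod_cast hc
      have hd' : (0 : ℝ) ≤ d := by exact_mod_cast hd
      rw [pow_succ]
      push_cast
      linarith

lemma t_bounds (k : ℕ) (hk : 1 ≤ k) : 2 * (3 / 2 : ℝ) ^ k ≤ t k ∧ t k ≤ 4 ^ k := by
  obtain ⟨m, rfl⟩ : ∃ m, k = m + 1 := ⟨k - 1, by omega⟩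
  obtain ⟨a, b, c, d, h, -, -, -, -, h1, h2⟩ := entries_aux m
  have ht : t (m + 1) = 2 * a + b + c + d := by
    unfold t A
    rw [Nat.add_sub_cancel, Matrix.SpecialLinearGroup.coe_mul, h,
      Matrix.SpecialLinearGroup.coe_mul]
    simp [R, L, Matrix.mul_fin_two, Matrix.trace_fin_two]
    ring
  rw [ht]
  exact ⟨h1, h2⟩

lemma log_bounds (k : ℕ) (hk : 1 ≤ k) :
    k * Real.log (3 / 2) ≤ Real.log (lam k) ∧ Real.log (lam k) ≤ k * Real.log 4 := by
  obtain ⟨h1, h2⟩ := t_bounds k hk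
  have hp : (0 : ℝ) < (3 / 2) ^ k := by positivity
  have hs := Real.sqrt_nonneg (t k ^ 2 - 4)
  have hs' : Real.sqrt (t k ^ 2 - 4) ≤ t k := by
    apply Real.sqrt_le_iff.2
    constructor <;> linarith
  have l1 : (3 / 2 : ℝ) ^ k ≤ lam k := by unfold lam; linarith
  have l2 : lam k ≤ 4 ^ k := by unfold lam; linarith
  rw [← Real.log_pow, ← Real.log_pow]
  exact ⟨Real.log_le_log hp l1, Real.log_le_log (by linarith) l2⟩

lemma sum_aux (c : ℝ) (n : ℕ) :
    ∑ k ∈ Finset.Icc 1 n, 2 * ((k : ℝ) * c) = n * (n + 1) * c := by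
  induction n with
  | zero => simp
  | succ n ih =>
    rw [Finset.sum_Icc_succ_top (by omega), ih]
    push_cast
    ring

/-- For every `n ≥ 1`, the total length `ℓ(Γ_n) = Σ_{k=1}^n 2·log(λ_k)` of the
first `n` modular geodesics satisfies
`(n²/2)·log(3/2) ≤ ℓ(Γ_n) ≤ 2n²·log(4)`; it is coarsely equivalent to `n²`. -/
theorem total_length_bounds (n : ℕ) (hn : 1 ≤ n) :
    ((n : ℝ) ^ 2 / 2) * Real.log (3 / 2) ≤
      ∑ k ∈ Finset.Icc 1 n, 2 * Real.log (lam k) ∧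
    ∑ k ∈ Finset.Icc 1 n, 2 * Real.log (lam k) ≤
      2 * (n : ℝ) ^ 2 * Real.log 4 := by
  have hn' : (1 : ℝ) ≤ n := by exact_mod_cast hn
  constructor
  · have hl : 0 ≤ Real.log (3 / 2) := Real.log_nonneg (by norm_num)
    calc ((n : ℝ) ^ 2 / 2) * Real.log (3 / 2) ≤ n * (n + 1) * Real.log (3 / 2) := by
          apply mul_le_mul_of_nonneg_right _ hl
          nlinarith
      _ = ∑ k ∈ Finset.Icc 1 n, 2 * ((k : ℝ) * Real.log (3 / 2)) := (sum_aux _ n).symm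
      _ ≤ _ := by
          apply Finset.sum_le_sum
          intro k hk
          have := (log_bounds k (Finset.mem_Icc.1 hk).1).1
          linarith
  · have hl : 0 ≤ Real.log 4 := Real.log_nonneg (by norm_num)
    calc _ ≤ ∑ k ∈ Finset.Icc 1 n, 2 * ((k : ℝ) * Real.log 4) := by
          apply Finset.sum_le_sum
          intro k hk
          have := (log_bounds k (Finset.mem_Icc.1 hk).1).2
          linarith
      _ = n * (n + 1) * Real.log 4 := sum_aux _ n
      _ ≤ _ := by
          apply mul_le_mul_of_nonneg_right _ hl
          nlinarith
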